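/- arXiv:0809.0400 — 2 statements merged into one kernel-verified Lean document; each statement's English description precedes it below -/
import Mathlib

section
/- Let m ≥ 3 and let $₁ = ⟨1, c₂, c₃⟩, $₂ = ⟨1, c₂, c₃, …, c_m⟩ and $₃ = ⟨1, c₂, c₃, …, c_m, c_{m+1}⟩ be three tight coin systems such that $₁ is canonical but $₂ is not. If $₃ is non-canonical, then there exists a counterexample x of $₃ of the form x = c_i + c_j with x > c_{m+1} and 1 < c_i ≤ c_j ≤ c_m (where c_i, c_j are coins of $₃). -/
/-- A coin system `⟨c 1, c 2, …, c m⟩` is a strictly increasing finite sequence of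
positive integers with `c 1 = 1` (only the values `c i` for `1 ≤ i ≤ m` matter). -/
def IsCoinSystem (m : ℕ) (c : ℕ → ℕ) : Prop :=
  c 1 = 1 ∧ ∀ i j, 1 ≤ i → i < j → j ≤ m → c i < c j

/-- `α` is a representation of `x` under the coin system `⟨c 1, …, c m⟩`. -/
def IsRepr (m : ℕ) (c : ℕ → ℕ) (x : ℕ) (α : ℕ → ℕ) : Prop :=
  ∑ i ∈ Finset.Icc 1 m, α i * c i = x

/-- The size of a representation, i.e. the total number of coins used. -/
def reprSize (m : ℕ) (α : ℕ → ℕ) : ℕ :=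
  ∑ i ∈ Finset.Icc 1 m, α i

/-- `α` is the greedy representation of `x`: a representation such that for every
`2 ≤ i ≤ m` the part of the sum using coins smaller than `c i` is `< c i`. -/
def IsGreedy (m : ℕ) (c : ℕ → ℕ) (x : ℕ) (α : ℕ → ℕ) : Prop :=
  IsRepr m c x α ∧
    ∀ i, 2 ≤ i → i ≤ m → ∑ j ∈ Finset.Icc 1 (i - 1), α j * c j < c i

/-- `α` is an optimal (minimum-size) representation of `x`. -/
def IsOpt (m : ℕ) (c : ℕ → ℕ) (x : ℕ) (α : ℕ → ℕ) : Prop :=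
  IsRepr m c x α ∧ ∀ β, IsRepr m c x β → reprSize m α ≤ reprSize m β

/-- `x` is a counterexample: the greedy representation of `x` is strictly larger
than some representation of `x` (equivalently, than an optimal one). -/
def IsCounterexample (m : ℕ) (c : ℕ → ℕ) (x : ℕ) : Prop :=
  ∃ γ β, IsGreedy m c x γ ∧ IsRepr m c x β ∧ reprSize m β < reprSize m γ

/-- A coin system is non-canonical if it has a counterexample. -/
def NonCanonical (m : ℕ) (c : ℕ → ℕ) : Prop :=
  ∃ x, IsCounterexample m c x

/-- A coin system is canonical if `|GRD(x)| = |OPT(x)|` for all `x`,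
i.e. it has no counterexample. -/
def IsCanonical (m : ℕ) (c : ℕ → ℕ) : Prop :=
  ∀ x, ¬ IsCounterexample m c x

/-- A coin system is tight if it has no counterexample smaller than its largest coin. -/
def Tight (m : ℕ) (c : ℕ → ℕ) : Prop :=
  ∀ x, x < c m → ¬ IsCounterexample m c x

/-- `x` is the smallest counterexample of the coin system. -/
def SmallestCounterexample (m : ℕ) (c : ℕ → ℕ) (x : ℕ) : Prop :=
  IsCounterexample m c x ∧ ∀ y, y < x → ¬ IsCounterexample m c y

/-- `x` is a sum of exactly `n` coins of the system `⟨c 1, …, c M⟩`. -/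
def SumOfCoins (M : ℕ) (c : ℕ → ℕ) (n x : ℕ) : Prop :=
  ∃ β, IsRepr M c x β ∧ reprSize M β = n

section CoinSums

variable {M : ℕ} {c : ℕ → ℕ}

theorem isRepr_add_single {y i : ℕ} {α : ℕ → ℕ} (h : IsRepr M c y α)
    (hi : i ∈ Finset.Icc 1 M) : IsRepr M c (c i + y) (α + Pi.single i 1) := by
  unfold IsRepr at *
  simp only [Pi.add_apply, add_mul, Finset.sum_add_distrib, h, Pi.single_apply, ite_mul, one_mul,
    zero_mul, Finset.sum_ite_eq', hi, if_true]
  omega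

theorem reprSize_add_single {i : ℕ} {α : ℕ → ℕ} (hi : i ∈ Finset.Icc 1 M) :
    reprSize M (α + Pi.single i 1) = reprSize M α + 1 := by
  simp only [reprSize, Pi.add_apply, Finset.sum_add_distrib, Pi.single_apply,
    Finset.sum_ite_eq', hi, if_true]

theorem exists_eq_add_single {α : ℕ → ℕ} {i : ℕ} (h : α i ≠ 0) :
    ∃ β : ℕ → ℕ, α = β + Pi.single i 1 := by
  refine ⟨α - Pi.single i 1, ?_⟩
  ext j
  by_cases hj : j = i
  · subst hj
    simp
    omega
  · simp [hj]

theorem isRepr_of_add_single {x i : ℕ} {α : ℕ → ℕ} (h : IsRepr M c x (α + Pi.single i 1))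
    (hi : i ∈ Finset.Icc 1 M) : ∃ y, x = c i + y ∧ IsRepr M c y α :=
  ⟨_, h.symm.trans (isRepr_add_single rfl hi), rfl⟩

namespace SumOfCoins

theorem zero : SumOfCoins M c 0 0 := ⟨0, by simp [IsRepr], by simp [reprSize]⟩

theorem add {n k x y : ℕ} (h : SumOfCoins M c n x) (h' : SumOfCoins M c k y) :
    SumOfCoins M c (n + k) (x + y) := by
  obtain ⟨α, rfl, rfl⟩ := h
  obtain ⟨β, rfl, rfl⟩ := h'
  exact ⟨α + β, by simp [IsRepr, add_mul, Finset.sum_add_distrib],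
    by simp [reprSize, Finset.sum_add_distrib]⟩

theorem coin {i : ℕ} (hi : i ∈ Finset.Icc 1 M) : SumOfCoins M c 1 (c i) :=
  ⟨0 + Pi.single i 1, isRepr_add_single (y := 0) (by simp [IsRepr]) hi, by
    rw [reprSize_add_single hi]; simp [reprSize]⟩

theorem exists_pop {n x : ℕ} (h : SumOfCoins M c n x) (hx : 0 < x) :
    ∃ i ∈ Finset.Icc 1 M, ∃ k y, n = k + 1 ∧ x = c i + y ∧ SumOfCoins M c k y := by
  obtain ⟨α, hα, rfl⟩ := h
  obtain ⟨i, hi, hne⟩ : ∃ i ∈ Finset.Icc 1 M, α i * c i ≠ 0 :=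
    Finset.exists_ne_zero_of_sum_ne_zero (by rw [show _ = x from hα]; omega)
  obtain ⟨β, rfl⟩ := exists_eq_add_single (left_ne_zero_of_mul hne)
  obtain ⟨y, hy, hβ⟩ := isRepr_of_add_single hα hi
  exact ⟨i, hi, _, y, reprSize_add_single hi, hy, β, hβ, rfl⟩

theorem eq_zero {x : ℕ} (h : SumOfCoins M c 0 x) : x = 0 := by
  by_contra hx
  obtain ⟨i, -, k, y, hk, -⟩ := h.exists_pop (Nat.pos_of_ne_zero hx)
  omega

end SumOfCoins

theorem IsCoinSystem.lt (hc : IsCoinSystem M c) {i j : ℕ} (hi : 1 ≤ i) (hij : i < j)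
    (hj : j ≤ M) : c i < c j := hc.2 i j hi hij hj

theorem IsCoinSystem.le (hc : IsCoinSystem M c) {i j : ℕ} (hi : 1 ≤ i) (hij : i ≤ j)
    (hj : j ≤ M) : c i ≤ c j := by
  rcases hij.eq_or_lt with rfl | h
  · rfl
  · exact (hc.lt hi h hj).le

theorem IsCoinSystem.pos (hc : IsCoinSystem M c) {i : ℕ} (hi : i ∈ Finset.Icc 1 M) :
    0 < c i := by
  rw [Finset.mem_Icc] at hi
  have := hc.le le_rfl hi.1 hi.2
  have := hc.1
  omega

theorem IsCoinSystem.lt_of_lt (hc : IsCoinSystem M c) {i j : ℕ} (hi : i ∈ Finset.Icc 1 M)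
    (hj : j ∈ Finset.Icc 1 M) (h : c i < c j) : i < j := by
  rw [Finset.mem_Icc] at hi hj
  by_contra! hle
  exact absurd (hc.le hj.1 hle hi.2) (by omega)

theorem IsCoinSystem.exists_largest (hc : IsCoinSystem M c) (hM : 1 ≤ M) {x : ℕ} (hx : 0 < x) :
    ∃ i ∈ Finset.Icc 1 M, c i ≤ x ∧ ∀ j ∈ Finset.Icc 1 M, i < j → x < c j := by
  have h1 : 1 ∈ (Finset.Icc 1 M).filter (c · ≤ x) := by
    simp [hc.1, hM]
    omega
  obtain ⟨i, hi, hmax⟩ := Finset.exists_max_image _ id ⟨1, h1⟩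
  rw [Finset.mem_filter] at hi
  refine ⟨i, hi.1, hi.2, fun j hj hij => ?_⟩
  by_contra! hle
  have : j ≤ i := hmax j (Finset.mem_filter.2 ⟨hj, hle⟩)
  omega

theorem IsGreedy.add_single {y i : ℕ} {γ : ℕ → ℕ} (h : IsGreedy M c y γ)
    (hi : i ∈ Finset.Icc 1 M) (hmax : ∀ j ∈ Finset.Icc 1 M, i < j → c i + y < c j) :
    IsGreedy M c (c i + y) (γ + Pi.single i 1) := by
  have hrep := isRepr_add_single h.1 hi
  refine ⟨hrep, fun t ht htM => ?_⟩
  by_cases hit : i < t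
  · refine lt_of_le_of_lt ?_ (hmax t (by simp; omega) hit)
    calc _ ≤ ∑ j ∈ Finset.Icc 1 M, (γ + Pi.single i 1 : ℕ → ℕ) j * c j :=
          Finset.sum_le_sum_of_subset (Finset.Icc_subset_Icc_right (by omega))
      _ = c i + y := hrep
  · refine lt_of_eq_of_lt (Finset.sum_congr rfl fun j hj => ?_) (h.2 t ht htM)
    rw [Finset.mem_Icc] at hj
    simp [show j ≠ i by omega]

theorem IsCoinSystem.exists_isGreedy (hc : IsCoinSystem M c) (hM : 1 ≤ M) (x : ℕ) :
    ∃ γ, IsGreedy M c x γ := by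
  induction x using Nat.strong_induction_on with
  | _ x ih =>
    rcases Nat.eq_zero_or_pos x with rfl | hx
    · exact ⟨0, by simp [IsRepr], fun i hi hiM => by
        simpa using hc.pos (i := i) (by simp; omega)⟩
    · obtain ⟨i, hi, hix, hmax⟩ := hc.exists_largest hM hx
      have := hc.pos hi
      obtain ⟨γ, hγ⟩ := ih (x - c i) (by omega)
      have hx' : c i + (x - c i) = x := by omega
      exact ⟨_, hx' ▸ hγ.add_single hi (hx'.symm ▸ hmax)⟩

/-- If `c i + y` is not a counterexample and `c i` is the largest coin not exceeding it, then any
representation can be replaced by one that is no larger and uses `c i`. -/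
theorem IsCoinSystem.sumOfCoins_of_not_counterexample (hc : IsCoinSystem M c)
    {i n y : ℕ} (hi : i ∈ Finset.Icc 1 M) (hmax : ∀ j ∈ Finset.Icc 1 M, i < j → c i + y < c j)
    (hx : ¬ IsCounterexample M c (c i + y)) (h : SumOfCoins M c n (c i + y)) :
    ∃ k < n, SumOfCoins M c k y := by
  rw [Finset.mem_Icc] at hi
  obtain ⟨γ, hγ⟩ := hc.exists_isGreedy (hi.1.trans hi.2) y
  obtain ⟨β, hβ, rfl⟩ := h
  rw [← Finset.mem_Icc] at hi
  refine ⟨reprSize M γ, ?_, γ, hγ.1, rfl⟩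
  by_contra! hlt
  exact hx ⟨_, β, hγ.add_single hi hmax, hβ, by rw [reprSize_add_single hi]; omega⟩

/-- Not every representation of a smallest counterexample that is smaller than the greedy one
can be replaced by one using the largest coin. -/
theorem SmallestCounterexample.exists_sumOfCoins {x : ℕ} (hM : 2 ≤ M)
    (hx : SmallestCounterexample M c x) (hpos : 0 < c M) :
    ∃ n, SumOfCoins M c n x ∧ ∀ k < n, ∀ y, x = c M + y → ¬ SumOfCoins M c k y := by
  obtain ⟨⟨γ, β, hγ, hβ, hlt⟩, hmin⟩ := hx
  have hMM : M ∈ Finset.Icc 1 M := by simp; omega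
  refine ⟨_, ⟨β, hβ, rfl⟩, ?_⟩
  rintro k hk y rfl ⟨δ, hδ, rfl⟩
  have hne : γ M ≠ 0 := by
    intro h0
    have h2 := hγ.2 M hM le_rfl
    have h1 : _ = c M + y := hγ.1
    obtain ⟨N, rfl⟩ : ∃ N, M = N + 1 := ⟨M - 1, by omega⟩
    rw [Finset.sum_Icc_succ_top (by omega), h0] at h1
    simp only [Nat.add_sub_cancel] at h2
    omega
  obtain ⟨γ', rfl⟩ := exists_eq_add_single hne
  obtain ⟨y', hy', hγ'⟩ := isRepr_of_add_single hγ.1 hMM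
  obtain rfl : y = y' := by omega
  rw [reprSize_add_single hMM] at hlt
  refine hmin y (by omega) ⟨γ', δ, ⟨hγ', fun t ht htM => ?_⟩, hδ, by omega⟩
  refine lt_of_eq_of_lt (Finset.sum_congr rfl fun j hj => ?_) (hγ.2 t ht htM)
  rw [Finset.mem_Icc] at hj
  simp [show j ≠ M by omega]

theorem NonCanonical.exists_smallest (h : NonCanonical M c) :
    ∃ x, SmallestCounterexample M c x := by
  classical
  exact ⟨Nat.find h, Nat.find_spec h, fun y hy => Nat.find_min h hy⟩

theorem SmallestCounterexample.lt_two_mul {x : ℕ} (hM : 2 ≤ M) (hc : IsCoinSystem M c)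
    (hx : SmallestCounterexample M c x) : x < 2 * c M := by
  have hMM : M ∈ Finset.Icc 1 M := by simp; omega
  have hpos := hc.pos hMM
  by_contra! hle
  obtain ⟨n, hn, hno⟩ := hx.exists_sumOfCoins hM hpos
  obtain ⟨i, hi, k, y, rfl, rfl, hk⟩ := hn.exists_pop (by omega)
  have hipos := hc.pos hi
  have hile : c i ≤ c M := hc.le (Finset.mem_Icc.1 hi).1 (Finset.mem_Icc.1 hi).2 le_rfl
  obtain ⟨z, rfl⟩ : ∃ z, y = c M + z := ⟨y - c M, by omega⟩
  obtain ⟨l, hl, hz⟩ := hc.sumOfCoins_of_not_counterexample hMM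
    (fun j hj h => by simp at hj; omega) (hx.2 _ (by omega)) hk
  exact hno (1 + l) (by omega) (c i + z) (by ring) ((SumOfCoins.coin hi).add hz)

theorem IsCounterexample.of_lt {m x : ℕ} (h : IsCounterexample m c x) (hx : x < c (m + 1)) :
    IsCounterexample (m + 1) c x := by
  obtain ⟨γ, β, hγ, hβ, hlt⟩ := h
  have key : ∀ α, IsRepr m c x α → IsRepr (m + 1) c x (fun j => if j = m + 1 then 0 else α j) ∧
      reprSize (m + 1) (fun j => if j = m + 1 then 0 else α j) = reprSize m α := by
    intro α hα
    constructor
    · unfold IsRepr at *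
      rw [Finset.sum_Icc_succ_top (by omega), ← hα]
      simp only [if_true, zero_mul, add_zero]
      refine Finset.sum_congr rfl fun j hj => ?_
      rw [Finset.mem_Icc] at hj
      simp [show j ≠ m + 1 by omega]
    · unfold reprSize
      rw [Finset.sum_Icc_succ_top (by omega)]
      simp only [if_true, add_zero]
      refine Finset.sum_congr rfl fun j hj => ?_
      rw [Finset.mem_Icc] at hj
      simp [show j ≠ m + 1 by omega]
  obtain ⟨h1, h2⟩ := key γ hγ.1
  obtain ⟨h3, h4⟩ := key β hβ
  refine ⟨_, _, ⟨h1, fun t ht htM => ?_⟩, h3, by omega⟩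
  have hsum : ∑ j ∈ Finset.Icc 1 (t - 1), (if j = m + 1 then 0 else γ j) * c j =
      ∑ j ∈ Finset.Icc 1 (t - 1), γ j * c j := by
    refine Finset.sum_congr rfl fun j hj => ?_
    rw [Finset.mem_Icc] at hj
    simp [show j ≠ m + 1 by omega]
  rw [hsum]
  rcases htM.eq_or_lt with rfl | hlt'
  · have : _ = x := hγ.1
    simpa [this] using hx
  · exact hγ.2 t ht (by omega)

end CoinSums

/-- A smallest counterexample above the largest coin is impossible when the two largest coins
are within a factor of two and no sum of two smaller coins is a counterexample. -/
theorem SmallestCounterexample.false_of_pairs {m : ℕ} {c : ℕ → ℕ} {x : ℕ} (hm : 1 ≤ m)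
    (hc : IsCoinSystem (m + 1) c) (hx : SmallestCounterexample (m + 1) c x)
    (hle : c (m + 1) ≤ x) (h2 : c (m + 1) < 2 * c m)
    (hpair : ∀ i ∈ Finset.Icc 1 m, ∀ j ∈ Finset.Icc 1 m, c (m + 1) < c i + c j →
      ¬ IsCounterexample (m + 1) c (c i + c j)) : False := by
  have hTT : m + 1 ∈ Finset.Icc 1 (m + 1) := by simp
  have hLL : m ∈ Finset.Icc 1 (m + 1) := by simp; omega
  have hTmax : ∀ z, ∀ j ∈ Finset.Icc 1 (m + 1), m + 1 < j → c (m + 1) + z < c j :=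
    fun z j hj h => by simp at hj; omega
  obtain ⟨n, hn, hno⟩ := hx.exists_sumOfCoins (by omega) (hc.pos hTT)
  have hLT : c m < c (m + 1) := hc.lt hm (by omega) le_rfl
  obtain ⟨d, hd⟩ : ∃ d, c (m + 1) = c m + d := ⟨c (m + 1) - c m, by omega⟩
  have hxT : c (m + 1) < x := by
    refine lt_of_le_of_ne hle fun h => ?_
    obtain ⟨i, hi, k, y, rfl, -⟩ := hn.exists_pop (by omega)
    exact hno 0 (by omega) 0 h.symm SumOfCoins.zero
  -- subtracting `d` from a coin larger than `d` yields a coin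
  have hsub : ∀ i ∈ Finset.Icc 1 (m + 1), d < c i → ∃ j ∈ Finset.Icc 1 (m + 1), c i = c j + d := by
    intro i hi hdi
    by_cases him : i = m + 1
    · exact ⟨m, hLL, him ▸ hd⟩
    · obtain ⟨y, hy⟩ : ∃ y, c i = y + d := ⟨c i - d, by omega⟩
      have hsum : c m + c i = c (m + 1) + y := by omega
      have hnc := hpair m (by simp; omega) i (by simp at hi ⊢; omega) (by omega)
      have hrep := (SumOfCoins.coin hLL).add (SumOfCoins.coin (c := c) hi)
      rw [hsum] at hnc hrep
      obtain ⟨k, hk, hky⟩ := hc.sumOfCoins_of_not_counterexample hTT (hTmax y) hnc hrep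
      obtain ⟨j, hj, k', z, rfl, rfl, hz⟩ := hky.exists_pop (by omega)
      obtain rfl : k' = 0 := by omega
      have := hz.eq_zero
      exact ⟨j, hj, by omega⟩
  -- removing any coin leaves less than the largest coin
  have hrem : ∀ j ∈ Finset.Icc 1 (m + 1), ∀ k, k + 1 ≤ n → ∀ y, x = c j + y →
      SumOfCoins (m + 1) c k y → y < c (m + 1) := by
    intro j hj k hk y hxy hy
    by_contra! hle
    obtain ⟨z, rfl⟩ : ∃ z, y = c (m + 1) + z := ⟨y - c (m + 1), by omega⟩
    have hjpos := hc.pos hj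
    obtain ⟨l, hl, hz⟩ := hc.sumOfCoins_of_not_counterexample hTT (hTmax z)
      (hx.2 _ (by omega)) hy
    exact hno (1 + l) (by omega) (c j + z) (by omega) ((SumOfCoins.coin hj).add hz)
  -- no representation of size at most `n` uses the coin `c m`
  have hnoL : ∀ k < n, ∀ y, x = c m + y → ¬ SumOfCoins (m + 1) c k y := by
    intro k hk y hxy hy
    obtain ⟨b, hb, k', z, rfl, rfl, hz⟩ := hy.exists_pop (by omega)
    have hlt := hrem b hb (1 + k') (by omega) (c m + z) (by omega) ((SumOfCoins.coin hLL).add hz)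
    have hbd : c b < d := by
      by_contra! hdb
      rcases hdb.eq_or_lt with h | h
      · exact hno k' (by omega) z (by omega) hz
      · obtain ⟨j, hj, hbj⟩ := hsub b hb h
        exact hno (1 + k') (by omega) (c j + z) (by omega) ((SumOfCoins.coin hj).add hz)
    obtain ⟨j, hj, hLj⟩ := hsub m hLL (by omega)
    have hrep := (SumOfCoins.coin hj).add ((SumOfCoins.coin hb).add hz)
    obtain ⟨w, hw⟩ : ∃ w, c j + (c b + z) = c m + w := ⟨c j + (c b + z) - c m, by omega⟩
    rw [hw] at hrep
    obtain ⟨l, hl, hlw⟩ := hc.sumOfCoins_of_not_counterexample hLL (fun t ht hmt => by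
      obtain rfl : t = m + 1 := by simp at ht; omega
      omega) (hx.2 _ (by omega)) hrep
    exact hno l (by omega) w (by omega) hlw
  -- take a representation whose largest coin is as large as possible
  classical
  obtain ⟨a, ha, hmaxa⟩ := Finset.exists_max_image
    ((Finset.Icc 1 (m + 1)).filter fun a => ∃ k < n, ∃ y, x = c a + y ∧ SumOfCoins (m + 1) c k y)
    id (by
      obtain ⟨i, hi, k, y, hk, hy, hs⟩ := hn.exists_pop (by omega)
      exact ⟨i, Finset.mem_filter.2 ⟨hi, k, by omega, y, hy, hs⟩⟩)
  obtain ⟨haI, k, hk, y, hxy, hy⟩ := Finset.mem_filter.1 ha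
  have hmax : ∀ b ∈ Finset.Icc 1 (m + 1), a < b → ∀ k < n, ∀ y, x = c b + y →
      ¬ SumOfCoins (m + 1) c k y := by
    intro b hb hab k hk y hxy hy
    have : b ≤ a := hmaxa b (Finset.mem_filter.2 ⟨hb, k, hk, y, hxy, hy⟩)
    omega
  have haT : a ≠ m + 1 := by
    rintro rfl
    exact hno k hk y hxy hy
  have haL : a ≠ m := by
    rintro rfl
    exact hnoL k hk y hxy hy
  have haI' := Finset.mem_Icc.1 haI
  have hcaL : c a < c m := hc.lt haI'.1 (by omega) (by omega)
  obtain ⟨b, hb, k', z, rfl, rfl, hz⟩ := hy.exists_pop (by omega)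
  have hbpos := hc.pos hb
  have hapos := hc.pos haI
  have hyb := (SumOfCoins.coin haI).add hz
  have hlt := hrem b hb (1 + k') (by omega) (c a + z) (by omega) hyb
  rcases le_or_gt (c b) d with hbd | hbd
  · obtain ⟨w, hw⟩ : ∃ w, c a + z = c m + w := ⟨c a + z - c m, by omega⟩
    rw [hw] at hyb
    obtain ⟨l, hl, hlw⟩ := hc.sumOfCoins_of_not_counterexample hLL (fun t ht hmt => by
      obtain rfl : t = m + 1 := by simp at ht; omega
      omega) (hx.2 _ (by omega)) hyb
    exact hnoL (1 + l) (by omega) (c b + w) (by omega) ((SumOfCoins.coin hb).add hlw)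
  · have hsI : a + 1 ∈ Finset.Icc 1 (m + 1) := by simp; omega
    have hnext : c (a + 1) ≤ c a + d := by
      by_contra! hgt
      obtain ⟨j, hj, hj'⟩ := hsub (a + 1) hsI (by omega)
      have := hc.lt_of_lt haI hj (by omega)
      have := hc.lt_of_lt hj hsI (by omega)
      omega
    obtain ⟨p, hp, hple, hpmax⟩ := hc.exists_largest (by omega) (x := c a + c b) (by omega)
    have hap : a < p := by
      by_contra! hpa
      have := hpmax (a + 1) hsI (by omega)
      omega
    obtain ⟨w, hw⟩ : ∃ w, c a + c b = c p + w := ⟨c a + c b - c p, by omega⟩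
    rw [hw] at hpmax
    have hnc : ¬ IsCounterexample (m + 1) c (c p + w) := by
      by_cases hz0 : z = 0
      · have hbT : b ≠ m + 1 := by
          rintro rfl
          exact hno (1 + k') (by omega) (c a + z) (by omega)
            ((SumOfCoins.coin haI).add hz)
        have hb' := Finset.mem_Icc.1 hb
        rw [← hw]
        exact hpair a (by simp; omega) b (by simp; omega) (by omega)
      · exact hx.2 _ (by omega)
    have hrep := (SumOfCoins.coin haI).add (SumOfCoins.coin (c := c) hb)
    rw [hw] at hrep
    obtain ⟨l, hl, hlw⟩ := hc.sumOfCoins_of_not_counterexample hp hpmax hnc hrep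
    exact hmax p hp hap (l + k') (by omega) (w + z) (by omega) (hlw.add hz)

/-- Let `$₁ = ⟨1, c 2, c 3⟩`, `$₂ = ⟨1, …, c m⟩`, `$₃ = ⟨1, …, c m, c (m+1)⟩` be tight
coin systems with `$₁` canonical but `$₂` non-canonical. If `$₃` is non-canonical, then
it has a counterexample `x = c i + c j > c (m+1)` with `1 < c i ≤ c j ≤ c m`. -/
theorem stmt_15 (m : ℕ) (hm : 3 ≤ m) (c : ℕ → ℕ)
    (hc : IsCoinSystem (m + 1) c)
    (ht1 : Tight 3 c) (ht2 : Tight m c) (ht3 : Tight (m + 1) c)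
    (hcan1 : IsCanonical 3 c) (hnon2 : NonCanonical m c)
    (hnon3 : NonCanonical (m + 1) c) :
    ∃ i j, 1 ≤ i ∧ i ≤ m + 1 ∧ 1 ≤ j ∧ j ≤ m + 1 ∧
      1 < c i ∧ c i ≤ c j ∧ c j ≤ c m ∧
      c (m + 1) < c i + c j ∧
      IsCounterexample (m + 1) c (c i + c j) := by
  obtain ⟨y, hy⟩ := hnon2.exists_smallest
  obtain ⟨x, hx⟩ := hnon3.exists_smallest
  have hc2 : IsCoinSystem m c := ⟨hc.1, fun i j hi hij hj => hc.2 i j hi hij (by omega)⟩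
  have hlt := hy.lt_two_mul (by omega) hc2
  have hle : c (m + 1) ≤ y := by
    by_contra! h
    exact ht3 y h (hy.1.of_lt h)
  have hxle : c (m + 1) ≤ x := by
    by_contra! h
    exact ht3 x h hx.1
  by_contra! hno
  refine hx.false_of_pairs (by omega) hc hxle (by omega) ?_
  have key : ∀ i ∈ Finset.Icc 1 m, ∀ j ∈ Finset.Icc 1 m, c i ≤ c j → c (m + 1) < c i + c j →
      ¬ IsCounterexample (m + 1) c (c i + c j) := by
    intro i hi j hj hij hgt
    rw [Finset.mem_Icc] at hi hj
    have hjm : c j ≤ c m := hc.le hj.1 hj.2 (by omega)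
    have hmT : c m < c (m + 1) := hc.lt (by omega) (by omega) le_rfl
    exact hno i j hi.1 (by omega) hj.1 (by omega) (by omega) hij hjm hgt
  intro i hi j hj hgt
  rcases le_total (c i) (c j) with h | h
  · exact key i hi j hj h hgt
  · rw [add_comm (c i)] at hgt ⊢
    exact key j hj i hi h hgt
end

section
/- Let m ≥ 3 and let $₁ = ⟨1, c₂, c₃⟩, $₂ = ⟨1, c₂, c₃, …, c_m⟩ and $₃ = ⟨1, c₂, c₃, …, c_m, c_{m+1}⟩ be three tight coin systems such that $₁ is canonical but $₂ and $₃ are both non-canonical. Define c₀ = 0 and dᵢ = cᵢ − c_{i−1} for 1 ≤ i ≤ m+1. If no number of the form c_m + c_i with c_m + c_i > c_{m+1} and 1 < c_i ≤ c_m is a counterexample of $₃, then d_{m+1} = max{ dᵢ : 1 ≤ i ≤ m+1 }. -/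
/-- Every number has a greedy representation as soon as the first coin is `1` and all coins
are positive. -/
theorem exists_isGreedy {c : ℕ → ℕ} (h1 : c 1 = 1) {n : ℕ} (hn : 1 ≤ n)
    (hpos : ∀ i, 1 ≤ i → i ≤ n → 0 < c i) (x : ℕ) : ∃ γ, IsGreedy n c x γ := by
  induction n, hn using Nat.le_induction generalizing x with
  | base => exact ⟨fun _ => x, by simp [IsRepr, h1], fun i h2 h => by omega⟩
  | succ n hn ih =>
    obtain ⟨γ, hγ, hlt⟩ := ih (fun i hi hin => hpos i hi (by omega)) (x % c (n + 1))
    have hsum : ∀ k ≤ n, ∑ j ∈ Finset.Icc 1 k,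
        Function.update γ (n + 1) (x / c (n + 1)) j * c j = ∑ j ∈ Finset.Icc 1 k, γ j * c j := by
      intro k hk
      refine Finset.sum_congr rfl fun j hj => ?_
      rw [Finset.mem_Icc] at hj
      rw [Function.update_of_ne (by omega)]
    unfold IsRepr at hγ
    refine ⟨Function.update γ (n + 1) (x / c (n + 1)), ?_, fun i h2 hi => ?_⟩
    · rw [IsRepr, Finset.sum_Icc_succ_top (by omega), hsum n le_rfl, hγ, Function.update_self,
        mul_comm, Nat.mod_add_div]
    · rw [hsum (i - 1) (by omega)]
      rcases Nat.lt_or_ge n i with h | h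
      · obtain rfl : i = n + 1 := by omega
        rw [Nat.add_sub_cancel, hγ]
        exact Nat.mod_lt _ (hpos _ (by omega) le_rfl)
      · exact hlt i h2 h

/-- The sum of two coins is represented by a representation of size two. -/
theorem exists_isRepr_add {n : ℕ} {c : ℕ → ℕ} {i j : ℕ} (hi : i ∈ Finset.Icc 1 n)
    (hj : j ∈ Finset.Icc 1 n) : ∃ β, IsRepr n c (c i + c j) β ∧ reprSize n β = 2 := by
  refine ⟨fun k => (if k = i then 1 else 0) + (if k = j then 1 else 0), ?_, ?_⟩
  · simp only [IsRepr, add_mul, ite_mul, one_mul, zero_mul, Finset.sum_add_distrib,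
      Finset.sum_ite_eq', hi, hj, if_true]
  · simp only [reprSize, Finset.sum_add_distrib, Finset.sum_ite_eq', hi, hj, if_true]

/-- A number strictly between two consecutive coins has no representation of size one. -/
theorem two_le_reprSize {n : ℕ} {c : ℕ → ℕ} {i r : ℕ} {α : ℕ → ℕ}
    (hmono : ∀ j k, 1 ≤ j → j ≤ k → k ≤ n → c j ≤ c k) (hi : 2 ≤ i) (hin : i ≤ n)
    (hα : IsRepr n c r α) (hlo : c (i - 1) < r) (hhi : r < c i) : 2 ≤ reprSize n α := by
  have hle : r ≤ reprSize n α * c (i - 1) := by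
    rw [← hα, reprSize, Finset.sum_mul]
    refine Finset.sum_le_sum fun j hj => ?_
    have hterm : α j * c j ≤ r := by
      rw [← hα]
      exact Finset.single_le_sum (f := fun j => α j * c j) (fun _ _ => Nat.zero_le _) hj
    rw [Finset.mem_Icc] at hj
    rcases Nat.lt_or_ge j i with h | h
    · exact Nat.mul_le_mul_left _ (hmono j (i - 1) hj.1 (by omega) (by omega))
    · have hij := hmono i j (by omega) h hj.2
      rcases Nat.eq_zero_or_pos (α j) with h0 | h0
      · simp [h0]
      · have := Nat.le_mul_of_pos_left (c j) h0
        omega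
  by_contra! hlt
  have := Nat.mul_le_mul_right (c (i - 1)) (Nat.le_of_lt_succ hlt)
  omega

/-- Let `$₁ = ⟨1, c 2, c 3⟩`, `$₂ = ⟨1, …, c m⟩`, `$₃ = ⟨1, …, c m, c (m+1)⟩` be tight
coin systems with `$₁` canonical and `$₂`, `$₃` non-canonical. With `c 0 = 0` and
`d i = c i - c (i-1)`: if no `c m + c i > c (m+1)` with `1 < c i ≤ c m` is a
counterexample of `$₃`, then `d (m+1)` is the maximum of the `d i`, `1 ≤ i ≤ m+1`. -/
theorem stmt_16 (m : ℕ) (hm : 3 ≤ m) (c : ℕ → ℕ) (hc0 : c 0 = 0)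
    (hc : IsCoinSystem (m + 1) c)
    (ht1 : Tight 3 c) (ht2 : Tight m c) (ht3 : Tight (m + 1) c)
    (hcan1 : IsCanonical 3 c) (hnon2 : NonCanonical m c)
    (hnon3 : NonCanonical (m + 1) c)
    (hno : ∀ i, 1 ≤ i → i ≤ m + 1 → 1 < c i → c i ≤ c m →
      c (m + 1) < c m + c i → ¬ IsCounterexample (m + 1) c (c m + c i)) :
    ∀ i, 1 ≤ i → i ≤ m + 1 → c i - c (i - 1) ≤ c (m + 1) - c m := by
  obtain ⟨h1, hlt⟩ := hc
  have hmono : ∀ j k, 1 ≤ j → j ≤ k → k ≤ m + 1 → c j ≤ c k := by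
    intro j k hj hjk hk
    rcases hjk.eq_or_lt with rfl | h
    · exact le_rfl
    · exact (hlt j k hj h hk).le
  have hpos : ∀ j, 1 ≤ j → j ≤ m + 1 → 0 < c j := fun j hj hjm => by
    have := hmono 1 j le_rfl hj hjm
    omega
  have hlast := hlt m (m + 1) (by omega) (by omega) le_rfl
  intro i hi him
  rcases him.eq_or_lt with rfl | him'
  · simp
  rcases hi.eq_or_lt with rfl | hi'
  · simp only [Nat.sub_self, hc0, h1]
    omega
  by_contra! hgap
  have hci := hmono i m hi (by omega) (by omega)
  obtain ⟨γ, hγ, hγlt⟩ := exists_isGreedy h1 (by omega : 1 ≤ m + 1) hpos (c m + c i)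
  obtain ⟨β, hβ, hβsize⟩ := exists_isRepr_add (c := c)
    (Finset.mem_Icc.2 ⟨by omega, by omega⟩ : m ∈ Finset.Icc 1 (m + 1))
    (Finset.mem_Icc.2 ⟨hi, him⟩)
  refine hno i hi him (h1 ▸ hlt 1 i le_rfl hi' him) hci (by omega) ⟨γ, β, ⟨hγ, hγlt⟩, hβ, ?_⟩
  have hrest := hγlt (m + 1) (by omega) le_rfl
  rw [Nat.add_sub_cancel] at hrest
  rw [IsRepr, Finset.sum_Icc_succ_top (by omega)] at hγ
  have htop : γ (m + 1) = 1 := by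
    have hne : γ (m + 1) ≠ 0 := fun h => by
      rw [h, zero_mul] at hγ
      omega
    have hlt2 : γ (m + 1) < 2 := by
      by_contra! h
      have := Nat.mul_le_mul_right (c (m + 1)) h
      omega
    omega
  rw [htop, one_mul] at hγ
  have hsize := two_le_reprSize (fun j k hj hjk hk => hmono j k hj hjk (by omega)) hi'
    (by omega : i ≤ m) (rfl : IsRepr m c _ γ) (by omega) (by omega)
  rw [hβsize, reprSize, Finset.sum_Icc_succ_top (by omega), htop]
  exact Nat.lt_succ_of_le hsize
end
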